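/- arXiv:0911.4467 — 3 statements merged into one kernel-verified Lean document; each statement's English description precedes it below -/
import Mathlib

section
/- Let Γ : ℝ × J → ℝ³ be a smooth map such that each Γ(·,t) is a pseudo-arc parametrized null curve with curvature κ(s,t) and Frenet frame (t,n,b). If ∂Γ/∂t = (2∂²κ/∂s² + 2κ²) t − 4(∂κ/∂s) n + 4κ b, then κ satisfies the fifth-order equation of the KdV hierarchy: ∂κ/∂t = −(∂⁵κ/∂s⁵ + 10κ ∂³κ/∂s³ + 20 (∂κ/∂s)(∂²κ/∂s²) + 30κ² ∂κ/∂s). -/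
noncomputable section

/-- The Minkowski bilinear form on `ℝ³`: `⟨x,y⟩ = -(x¹y³ + x³y¹) + x²y²`. -/
def mink (x y : Fin 3 → ℝ) : ℝ := -(x 0 * y 2 + x 2 * y 0) + x 1 * y 1

/-- Partial derivative in the first (space) variable, vector-valued. -/
def dsV (f : ℝ → ℝ → Fin 3 → ℝ) : ℝ → ℝ → Fin 3 → ℝ := fun s t => deriv (fun x => f x t) s

/-- Partial derivative in the second (time) variable, vector-valued. -/
def dtV (f : ℝ → ℝ → Fin 3 → ℝ) : ℝ → ℝ → Fin 3 → ℝ := fun s t => deriv (fun x => f s x) t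

/-- Partial derivative in the first (space) variable, scalar-valued. -/
def dsR (f : ℝ → ℝ → ℝ) : ℝ → ℝ → ℝ := fun s t => deriv (fun x => f x t) s

/-- Partial derivative in the second (time) variable, scalar-valued. -/
def dtR (f : ℝ → ℝ → ℝ) : ℝ → ℝ → ℝ := fun s t => deriv (fun x => f s x) t

open scoped ContDiff in
def SmJ {E : Type*} [NormedAddCommGroup E] [NormedSpace ℝ E] (J : Set ℝ) (f : ℝ → ℝ → E) : Prop :=
  ContDiffOn ℝ ∞ (fun p : ℝ × ℝ => f p.1 p.2) (Set.univ ×ˢ J)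

section gen
variable {E : Type*} [NormedAddCommGroup E] [NormedSpace ℝ E] {J : Set ℝ} {f : ℝ → ℝ → E}

open scoped ContDiff in
theorem SmJ.cda (hJ : IsOpen J) (hf : SmJ J f) (s : ℝ) {t : ℝ} (ht : t ∈ J) :
    ContDiffAt ℝ ∞ (fun p : ℝ × ℝ => f p.1 p.2) (s, t) :=
  ContDiffOn.contDiffAt hf ((isOpen_univ.prod hJ).mem_nhds ⟨trivial, ht⟩)

theorem SmJ.hs (hJ : IsOpen J) (hf : SmJ J f) (s : ℝ) {t : ℝ} (ht : t ∈ J) :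
    HasDerivAt (fun x => f x t) (fderiv ℝ (fun p : ℝ × ℝ => f p.1 p.2) (s, t) (1, 0)) s := by
  have h := ((hf.cda hJ s ht).differentiableAt (by simp)).hasFDerivAt
  exact h.comp_hasDerivAt (f := fun x : ℝ => (x, t)) s ((hasDerivAt_id s).prodMk (hasDerivAt_const s t))

theorem SmJ.ht (hJ : IsOpen J) (hf : SmJ J f) (s : ℝ) {t : ℝ} (ht : t ∈ J) :
    HasDerivAt (fun x => f s x) (fderiv ℝ (fun p : ℝ × ℝ => f p.1 p.2) (s, t) (0, 1)) t := by
  have h := ((hf.cda hJ s ht).differentiableAt (by simp)).hasFDerivAt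
  exact h.comp_hasDerivAt (f := fun x : ℝ => (s, x)) t ((hasDerivAt_const t s).prodMk (hasDerivAt_id t))

theorem SmJ.fd (hJ : IsOpen J) (hf : SmJ J f) (v : ℝ × ℝ) :
    SmJ J (fun s t => fderiv ℝ (fun p : ℝ × ℝ => f p.1 p.2) (s, t) v) := by
  have h := ContDiffOn.fderiv_of_isOpen (m := (⊤ : ℕ∞)) hf (isOpen_univ.prod hJ) (by simp)
  exact h.clm_apply contDiffOn_const

theorem SmJ.ds (hJ : IsOpen J) (hf : SmJ J f) : SmJ J (fun s t => deriv (fun x => f x t) s) :=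
  ContDiffOn.congr (hf.fd hJ (1, 0)) fun p hp => (hf.hs hJ p.1 hp.2).deriv

theorem SmJ.dt (hJ : IsOpen J) (hf : SmJ J f) : SmJ J (fun s t => deriv (fun x => f s x) t) :=
  ContDiffOn.congr (hf.fd hJ (0, 1)) fun p hp => (hf.ht hJ p.1 hp.2).deriv

theorem SmJ.comm (hJ : IsOpen J) (hf : SmJ J f) (s : ℝ) {t : ℝ} (ht : t ∈ J) :
    deriv (fun y => deriv (fun x => f x y) s) t = deriv (fun x => deriv (fun y => f x y) t) s := by
  have e1 : (fun y => deriv (fun x => f x y) s) =ᶠ[nhds t]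
      fun y => fderiv ℝ (fun p : ℝ × ℝ => f p.1 p.2) (s, y) (1, 0) := by
    filter_upwards [hJ.mem_nhds ht] with y hy using (hf.hs hJ s hy).deriv
  have e2 : (fun x => deriv (fun y => f x y) t) =
      fun x => fderiv ℝ (fun p : ℝ × ℝ => f p.1 p.2) (x, t) (0, 1) := by
    funext x; exact (hf.ht hJ x ht).deriv
  rw [e1.deriv_eq, e2]
  have c := hf.cda hJ s ht
  have hsym : IsSymmSndFDerivAt ℝ (fun p : ℝ × ℝ => f p.1 p.2) (s, t) :=
    c.isSymmSndFDerivAt (by simp only [minSmoothness_of_isRCLikeNormedField]; exact WithTop.coe_le_coe.2 le_top)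
  have hd : DifferentiableAt ℝ (fderiv ℝ (fun p : ℝ × ℝ => f p.1 p.2)) (s, t) :=
    (c.fderiv_right (m := 1) (WithTop.coe_le_coe.2 le_top : ((1 + 1 : ℕ∞) : WithTop ℕ∞) ≤ _)).differentiableAt (by simp)
  have h1 := hd.hasFDerivAt.comp_hasDerivAt (f := fun x : ℝ => (s, x)) t
    ((hasDerivAt_const t s).prodMk (hasDerivAt_id t))
  have h2 := hd.hasFDerivAt.comp_hasDerivAt (f := fun x : ℝ => (x, t)) s
    ((hasDerivAt_id s).prodMk (hasDerivAt_const s t))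
  have h1' := h1.clm_apply (hasDerivAt_const t ((1 : ℝ), (0 : ℝ)))
  have h2' := h2.clm_apply (hasDerivAt_const s ((0 : ℝ), (1 : ℝ)))
  have := hsym.eq (0, 1) (1, 0)
  have a1 := h1'.deriv
  have a2 := h2'.deriv
  simp only [Function.comp_def, map_zero, add_zero] at a1 a2
  rw [a1, a2]
  exact this

theorem SmJ.hds (hJ : IsOpen J) (hf : SmJ J f) (s : ℝ) {t : ℝ} (ht : t ∈ J) :
    HasDerivAt (fun x => f x t) (deriv (fun x => f x t) s) s :=
  (hf.hs hJ s ht).differentiableAt.hasDerivAt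

theorem SmJ.hdt (hJ : IsOpen J) (hf : SmJ J f) (s : ℝ) {t : ℝ} (ht : t ∈ J) :
    HasDerivAt (fun x => f s x) (deriv (fun x => f s x) t) t :=
  (hf.ht hJ s ht).differentiableAt.hasDerivAt
end gen

theorem mink_hasDerivAt {u v : ℝ → Fin 3 → ℝ} {u' v' : Fin 3 → ℝ} {x : ℝ}
    (hu : HasDerivAt u u' x) (hv : HasDerivAt v v' x) :
    HasDerivAt (fun y => mink (u y) (v y)) (mink u' (v x) + mink (u x) v') x := by
  have hu := hasDerivAt_pi.1 hu
  have hv := hasDerivAt_pi.1 hv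
  unfold mink
  refine ((((hu 0).mul (hv 2)).add ((hu 2).mul (hv 0))).neg.add ((hu 1).mul (hv 1))).congr_deriv ?_
  ring

theorem mink_comm (x y : Fin 3 → ℝ) : mink x y = mink y x := by unfold mink; ring
theorem mink_add_left (x y z : Fin 3 → ℝ) : mink (x + y) z = mink x z + mink y z := by
  simp only [mink, Pi.add_apply]; ring
theorem mink_smul_left (a : ℝ) (x z : Fin 3 → ℝ) : mink (a • x) z = a * mink x z := by
  simp only [mink, Pi.smul_apply, smul_eq_mul]; ring

theorem mink_nondeg {T N Q w : Fin 3 → ℝ} (tt : mink T T = 0) (tn : mink T N = 0)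
    (tq : mink T Q = -1) (nn : mink N N = 1) (nq : mink N Q = 0)
    (wt : mink w T = 0) (wn : mink w N = 0) (wq : mink w Q = 0) : w = 0 := by
  set D := T 0 * (N 1 * Q 2 - N 2 * Q 1) - T 1 * (N 0 * Q 2 - N 2 * Q 0)
    + T 2 * (N 0 * Q 1 - N 1 * Q 0) with hD
  have h1 : D ^ 2 = -(mink T T * (mink N N * mink Q Q - mink N Q ^ 2)
      - mink T N * (mink T N * mink Q Q - mink N Q * mink T Q)
      + mink T Q * (mink T N * mink N Q - mink N N * mink T Q)) := by
    rw [hD]; unfold mink; ring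
  rw [tt, tn, tq, nn, nq] at h1
  have hD0 : D ≠ 0 := by rintro h; rw [h] at h1; norm_num at h1
  unfold mink at wt wn wq
  have z0 : D * w 0 = 0 := by
    rw [hD]
    linear_combination -(N 0 * Q 1 - N 1 * Q 0) * wt - (Q 0 * T 1 - Q 1 * T 0) * wn - (T 0 * N 1 - T 1 * N 0) * wq
  have z1 : D * w 1 = 0 := by
    rw [hD]
    linear_combination (N 2 * Q 0 - N 0 * Q 2) * wt + (Q 2 * T 0 - Q 0 * T 2) * wn + (T 2 * N 0 - T 0 * N 2) * wq
  have z2 : D * w 2 = 0 := by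
    rw [hD]
    linear_combination -(N 1 * Q 2 - N 2 * Q 1) * wt - (Q 1 * T 2 - Q 2 * T 1) * wn - (T 1 * N 2 - T 2 * N 1) * wq
  funext i
  fin_cases i
  · simpa [hD0] using z0
  · simpa [hD0] using z1
  · simpa [hD0] using z2

theorem comb_hasDerivAt {T N Q : ℝ → Fin 3 → ℝ} {a b c : ℝ → ℝ} {k a' b' c' k' x : ℝ}
    (hT : HasDerivAt T (N x) x) (hN : HasDerivAt N (Q x) x)
    (hQ : HasDerivAt Q ((-2 * k') • T x + (-4 * k) • N x) x)
    (ha : HasDerivAt a a' x) (hb : HasDerivAt b b' x) (hc : HasDerivAt c c' x) :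
    HasDerivAt (fun y => a y • T y + b y • N y + c y • Q y)
      ((a' - 2 * k' * c x) • T x + (a x + b' - 4 * k * c x) • N x + (b x + c') • Q x) x := by
  refine (((ha.smul hT).add (hb.smul hN)).add (hc.smul hQ)).congr_deriv ?_
  module

/-- if a motion of pseudo-arc parametrized null curves satisfies
`∂Γ/∂t = (2κ_ss + 2κ²) t - 4κ_s n + 4κ b`, then the curvature satisfies the fifth-order
KdV hierarchy equation `κ_t = -(κ_sssss + 10κκ_sss + 20κ_sκ_ss + 30κ²κ_s)`. -/
theorem stmt11 (J : Set ℝ) (hJopen : IsOpen J) (hJconn : J.OrdConnected)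
    (Γ : ℝ → ℝ → Fin 3 → ℝ)
    (hΓ : ContDiffOn ℝ (⊤ : ℕ∞) (fun p : ℝ × ℝ => Γ p.1 p.2) (Set.univ ×ˢ J))
    (hnull : ∀ s : ℝ, ∀ t ∈ J, mink (dsV Γ s t) (dsV Γ s t) = 0)
    (hfut : ∀ s : ℝ, ∀ t ∈ J, mink (dsV Γ s t) ![1, 0, 1] < 0)
    (hpa : ∀ s : ℝ, ∀ t ∈ J, mink (dsV (dsV Γ) s t) (dsV (dsV Γ) s t) = 1)
    (κ : ℝ → ℝ → ℝ)
    (hκ : ∀ s t, κ s t = (1/4) * mink (dsV (dsV (dsV Γ)) s t) (dsV (dsV (dsV Γ)) s t))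
    (T N B : ℝ → ℝ → Fin 3 → ℝ)
    (hT : ∀ s t, T s t = dsV Γ s t)
    (hN : ∀ s t, N s t = dsV (dsV Γ) s t)
    (hB : ∀ s t, B s t = dsV (dsV (dsV Γ)) s t + (2 * κ s t) • dsV Γ s t)
    (hmotion : ∀ s : ℝ, ∀ t ∈ J,
      dtV Γ s t = (2 * dsR (dsR κ) s t + 2 * (κ s t) ^ 2) • T s t +
        (-(4 * dsR κ s t)) • N s t + (4 * κ s t) • B s t) :
    ∀ s : ℝ, ∀ t ∈ J,
      dtR κ s t =
        -(dsR (dsR (dsR (dsR (dsR κ)))) s t + 10 * κ s t * dsR (dsR (dsR κ)) s t +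
          20 * dsR κ s t * dsR (dsR κ) s t + 30 * (κ s t) ^ 2 * dsR κ s t) := by
  intro s t ht
  have S0 : SmJ J Γ := hΓ
  have S1 : SmJ J (dsV Γ) := S0.ds hJopen
  have S2 : SmJ J (dsV (dsV Γ)) := S1.ds hJopen
  have S3 : SmJ J (dsV (dsV (dsV Γ))) := S2.ds hJopen
  have K0 : SmJ J κ := by
    have hc : ∀ i, ContDiffOn ℝ (⊤ : ℕ∞) (fun p : ℝ × ℝ => dsV (dsV (dsV Γ)) p.1 p.2 i)
        (Set.univ ×ˢ J) := fun i => contDiffOn_pi.1 S3 i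
    have : SmJ J (fun s t => (1/4) * mink (dsV (dsV (dsV Γ)) s t) (dsV (dsV (dsV Γ)) s t)) := by
      unfold mink
      exact contDiffOn_const.mul (((((hc 0).mul (hc 2)).add ((hc 2).mul (hc 0))).neg).add
        ((hc 1).mul (hc 1)))
    exact ContDiffOn.congr this fun p _ => hκ p.1 p.2
  have K1 : SmJ J (dsR κ) := K0.ds hJopen
  have K2 : SmJ J (dsR (dsR κ)) := K1.ds hJopen
  have K3 : SmJ J (dsR (dsR (dsR κ))) := K2.ds hJopen
  have K4 : SmJ J (dsR (dsR (dsR (dsR κ)))) := K3.ds hJopen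
  -- commutation
  have c3 : dtV (dsV (dsV (dsV Γ))) s t = dsV (dsV (dsV (dtV Γ))) s t := by
    have e1 : ∀ x, dtV (dsV Γ) x t = dsV (dtV Γ) x t := fun x => S0.comm hJopen x ht
    have e2 : ∀ x, dtV (dsV (dsV Γ)) x t = dsV (dsV (dtV Γ)) x t := fun x =>
      (S1.comm hJopen x ht).trans (congrArg (fun g => deriv g x) (funext e1))
    exact (S2.comm hJopen s ht).trans (congrArg (fun g => deriv g s) (funext e2))
  have hdtk : dtR κ s t = (1/2) * mink (dtV (dsV (dsV (dsV Γ))) s t) (dsV (dsV (dsV Γ)) s t) := by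
    have h := S3.hdt hJopen s ht
    have h2 := (mink_hasDerivAt h h).const_mul (1/4)
    have e : (fun x => κ s x) = fun x => 1/4 * mink (dsV (dsV (dsV Γ)) s x) (dsV (dsV (dsV Γ)) s x) :=
      funext fun x => hκ s x
    unfold dtR
    rw [e, h2.deriv]
    rw [mink_comm (dsV (dsV (dsV Γ)) s t) (deriv _ _)]
    change _ = 1/2 * mink (deriv (fun x => dsV (dsV (dsV Γ)) s x) t) _
    ring
  rw [hdtk, c3]
  -- fix t
  obtain ⟨T', hT'⟩ : ∃ g, g = fun x => dsV Γ x t := ⟨_, rfl⟩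
  obtain ⟨N', hN'⟩ : ∃ g, g = fun x => dsV (dsV Γ) x t := ⟨_, rfl⟩
  obtain ⟨Q, hQ'⟩ : ∃ g, g = fun x => dsV (dsV (dsV Γ)) x t := ⟨_, rfl⟩
  obtain ⟨k0, h0⟩ : ∃ g, g = fun x => κ x t := ⟨_, rfl⟩
  obtain ⟨k1, h1⟩ : ∃ g, g = fun x => dsR κ x t := ⟨_, rfl⟩
  obtain ⟨k2, h2⟩ : ∃ g, g = fun x => dsR (dsR κ) x t := ⟨_, rfl⟩
  obtain ⟨k3, h3⟩ : ∃ g, g = fun x => dsR (dsR (dsR κ)) x t := ⟨_, rfl⟩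
  obtain ⟨k4, h4⟩ : ∃ g, g = fun x => dsR (dsR (dsR (dsR κ))) x t := ⟨_, rfl⟩
  obtain ⟨k5, h5⟩ : ∃ g, g = fun x => dsR (dsR (dsR (dsR (dsR κ)))) x t := ⟨_, rfl⟩
  have dT : ∀ x, HasDerivAt T' (N' x) x := by
    subst hT' hN'; exact fun x => S1.hds hJopen x ht
  have dN : ∀ x, HasDerivAt N' (Q x) x := by
    subst hQ' hN'; exact fun x => S2.hds hJopen x ht
  have dQ : ∀ x, HasDerivAt Q (deriv Q x) x := by
    subst hQ'; exact fun x => S3.hds hJopen x ht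
  have d0 : ∀ x, HasDerivAt k0 (k1 x) x := by
    subst h0 h1; exact fun x => K0.hds hJopen x ht
  have d1 : ∀ x, HasDerivAt k1 (k2 x) x := by
    subst h1 h2; exact fun x => K1.hds hJopen x ht
  have d2 : ∀ x, HasDerivAt k2 (k3 x) x := by
    subst h2 h3; exact fun x => K2.hds hJopen x ht
  have d3 : ∀ x, HasDerivAt k3 (k4 x) x := by
    subst h3 h4; exact fun x => K3.hds hJopen x ht
  have d4 : ∀ x, HasDerivAt k4 (k5 x) x := by
    subst h4 h5; exact fun x => K4.hds hJopen x ht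
  -- Gram relations
  have key : ∀ {u v : ℝ → Fin 3 → ℝ} {u' v' : Fin 3 → ℝ} {c : ℝ → ℝ} {c' x : ℝ},
      (∀ y, mink (u y) (v y) = c y) → HasDerivAt u u' x → HasDerivAt v v' x →
      HasDerivAt c c' x → mink u' (v x) + mink (u x) v' = c' := by
    intro u v u' v' c c' x h hu hv hc
    have := mink_hasDerivAt hu hv
    rw [funext h] at this
    exact this.unique hc
  have tt : ∀ x, mink (T' x) (T' x) = 0 := by subst hT'; exact fun x => hnull x t ht
  have nn : ∀ x, mink (N' x) (N' x) = 1 := by subst hN'; exact fun x => hpa x t ht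
  have qq : ∀ x, mink (Q x) (Q x) = 4 * k0 x := by
    subst hQ' h0; intro x; have := hκ x t; simp only; linarith
  have tn : ∀ x, mink (T' x) (N' x) = 0 := by
    intro x
    have := key tt (dT x) (dT x) (hasDerivAt_const x 0)
    rw [mink_comm (N' x)] at this; linarith
  have nq : ∀ x, mink (N' x) (Q x) = 0 := by
    intro x
    have := key nn (dN x) (dN x) (hasDerivAt_const x 1)
    rw [mink_comm (Q x)] at this; linarith
  have tq : ∀ x, mink (T' x) (Q x) = -1 := by
    intro x
    have := key tn (dT x) (dN x) (hasDerivAt_const x 0)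
    rw [nn] at this; linarith
  have rT : ∀ x, mink (deriv Q x) (T' x) = 0 := by
    intro x
    have := key tq (dT x) (dQ x) (hasDerivAt_const x (-1))
    rw [nq, mink_comm (T' x)] at this; linarith
  have rN : ∀ x, mink (deriv Q x) (N' x) = -4 * k0 x := by
    intro x
    have := key nq (dN x) (dQ x) (hasDerivAt_const x 0)
    rw [qq, mink_comm (N' x)] at this; linarith
  have rQ : ∀ x, mink (deriv Q x) (Q x) = 2 * k1 x := by
    intro x
    have := key qq (dQ x) (dQ x) ((d0 x).const_mul 4)
    rw [mink_comm (Q x)] at this; linarith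
  have eQ : ∀ x, deriv Q x = (-2 * k1 x) • T' x + (-4 * k0 x) • N' x := by
    intro x
    have hw : deriv Q x + (2 * k1 x) • T' x + (4 * k0 x) • N' x = 0 := by
      refine mink_nondeg (tt x) (tn x) (tq x) (nn x) (nq x) ?_ ?_ ?_ <;>
        simp only [mink_add_left, mink_smul_left, rT, rN, rQ, tt, tn, tq, nn, nq,
          mink_comm (N' x) (T' x)] <;> ring
    have : deriv Q x = (deriv Q x + (2 * k1 x) • T' x + (4 * k0 x) • N' x)
      + ((-2 * k1 x) • T' x + (-4 * k0 x) • N' x) := by module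
    rw [this, hw, zero_add]
  have dQ' : ∀ x, HasDerivAt Q ((-2 * k1 x) • T' x + (-4 * k0 x) • N' x) x := by
    intro x; rw [← eQ]; exact dQ x
  have v0 : (fun x => dtV Γ x t) = fun x => (2 * k2 x + 10 * (k0 x * k0 x)) • T' x +
      (-4 * k1 x) • N' x + (4 * k0 x) • Q x := by
    funext x
    rw [hmotion x t ht, hT, hN, hB]
    subst hT' hN' hQ' h0 h1 h2
    module
  have v1 : (fun x => dsV (dtV Γ) x t) = fun x => (2 * k3 x + 12 * (k0 x * k1 x)) • T' x +
      (0 : ℝ) • N' x + (0 : ℝ) • Q x + (-2 * k2 x - 6 * (k0 x * k0 x)) • N' x := by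
    funext x
    change deriv (fun x => dtV Γ x t) x = _
    rw [v0]
    refine (comb_hasDerivAt (dT x) (dN x) (dQ' x)
      (((d2 x).const_mul 2).add (((d0 x).mul (d0 x)).const_mul 10))
      ((d1 x).const_mul (-4)) ((d0 x).const_mul 4)).deriv.trans ?_
    simp only [Pi.add_apply, Pi.mul_apply]
    module
  have v1' : (fun x => dsV (dtV Γ) x t) = fun x => (2 * k3 x + 12 * (k0 x * k1 x)) • T' x +
      (-2 * k2 x + (-6) * (k0 x * k0 x)) • N' x + (0 : ℝ) • Q x := by
    rw [v1]; funext x; module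
  have v2 : (fun x => dsV (dsV (dtV Γ)) x t) = fun x =>
      (2 * k4 x + 12 * (k1 x * k1 x + k0 x * k2 x)) • T' x +
      (0 : ℝ) • N' x + (-2 * k2 x + (-6) * (k0 x * k0 x)) • Q x := by
    funext x
    change deriv (fun x => dsV (dtV Γ) x t) x = _
    rw [v1']
    refine (comb_hasDerivAt (dT x) (dN x) (dQ' x)
      (((d3 x).const_mul 2).add (((d0 x).mul (d1 x)).const_mul 12))
      (((d2 x).const_mul (-2)).add (((d0 x).mul (d0 x)).const_mul (-6)))
      (hasDerivAt_const x 0)).deriv.trans ?_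
    simp only [Pi.add_apply, Pi.mul_apply]
    module
  have v3 := (comb_hasDerivAt (dT s) (dN s) (dQ' s)
      (((d4 s).const_mul 2).add ((((d1 s).mul (d1 s)).add ((d0 s).mul (d2 s))).const_mul 12))
      (hasDerivAt_const s 0)
      (((d2 s).const_mul (-2)).add (((d0 s).mul (d0 s)).const_mul (-6)))).deriv
  have v4 := (congrArg (fun g => deriv g s) v2).trans v3
  have v5 : dsV (dsV (dsV (dtV Γ))) s t = deriv (fun x => dsV (dsV (dtV Γ)) x t) s := rfl
  rw [v5.trans v4]
  have g0 := congrFun h0 s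
  have g1 := congrFun h1 s
  have g2 := congrFun h2 s
  have g3 := congrFun h3 s
  have g5 := congrFun h5 s
  have gQ := congrFun hQ' s
  rw [← g0, ← g1, ← g2, ← g3, ← g5, ← gQ]
  simp only [mink_add_left, mink_smul_left, tq, nq, qq, Pi.add_apply, Pi.mul_apply]
  ring
end
end

section
/- Let λ ∈ ℝ and let κ : ℝ → ℝ be a smooth solution of κ''' + 6κκ' = λκ'. Define the 4×4 real matrix functions K(s) with rows (0,0,0,0), (1,0,−2κ,0), (0,1,0,−2κ), (0,0,1,0), and P(s) with rows (0,0,0,0), (2κ, 2κ', 2κ''+4κ², 0), (0, −2κ, 0, 2κ''+4κ²), (2, 0, −2κ, −2κ'), and set L := P + λK. Then L'(s) = L(s)K(s) − K(s)L(s) for all s (Lax pair). Consequently, if F : ℝ → GL(4,ℝ) is a smooth solution of F' = F·K, then the matrix F(s)L(s)F(s)⁻¹ is constant in s. -/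
noncomputable section

section
attribute [local instance] Matrix.linftyOpNormedRing Matrix.linftyOpNormedAlgebra

theorem aux_inv {A : ℝ → Matrix (Fin 4) (Fin 4) ℝ} {A' : Matrix (Fin 4) (Fin 4) ℝ} {s : ℝ}
    (hA : HasDerivAt A A' s) (hu : IsUnit (A s)) :
    HasDerivAt (fun x => (A x)⁻¹) (-((A s)⁻¹ * A' * (A s)⁻¹)) s := by
  have : CompleteSpace (Matrix (Fin 4) (Fin 4) ℝ) := FiniteDimensional.complete ℝ _
  obtain ⟨u, hu⟩ := hu
  have h := hasFDerivAt_ringInverse (𝕜 := ℝ) u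
  rw [hu] at h
  have h2 := h.comp_hasDerivAt s hA
  have e : (↑u⁻¹ : Matrix (Fin 4) (Fin 4) ℝ) = (A s)⁻¹ := by
    rw [← hu, Matrix.coe_units_inv]
  simp only [Matrix.nonsing_inv_eq_ringInverse] at *
  simp [e, Function.comp_def] at h2
  exact h2

end

attribute [local instance] Matrix.normedAddCommGroup Matrix.normedSpace

theorem aux_iff {A : ℝ → Matrix (Fin 4) (Fin 4) ℝ} {A' : Matrix (Fin 4) (Fin 4) ℝ} {s : ℝ} :
    HasDerivAt A A' s ↔ ∀ i j, HasDerivAt (fun x => A x i j) (A' i j) s := by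
  refine Iff.trans (hasDerivAt_pi (φ := fun x i => A x i) (φ' := fun i => A' i) (x := s)) ?_
  exact forall_congr' fun i => hasDerivAt_pi

theorem aux_mul {A B : ℝ → Matrix (Fin 4) (Fin 4) ℝ} {A' B' : Matrix (Fin 4) (Fin 4) ℝ} {s : ℝ}
    (hA : HasDerivAt A A' s) (hB : HasDerivAt B B' s) :
    HasDerivAt (fun x => A x * B x) (A' * B s + A s * B') s := by
  rw [aux_iff] at *
  intro i j
  simp only [Matrix.mul_apply, Matrix.add_apply, ← Finset.sum_add_distrib]
  exact HasDerivAt.fun_sum fun k _ => (hA i k).mul (hB k j)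

/-- for a solution `κ` of `κ''' + 6κκ' = λκ'`, the matrices
`K` (Frenet matrix) and `L = P + λK` form a Lax pair, `L' = [L, K] = LK - KL`;
consequently `F L F⁻¹` is a conserved quantity along any solution of `F' = F·K`. -/
theorem stmt15 (lam : ℝ) (κ : ℝ → ℝ) (hκ : ContDiff ℝ (⊤ : ℕ∞) κ)
    (hode : ∀ s : ℝ,
      deriv (deriv (deriv κ)) s + 6 * κ s * deriv κ s = lam * deriv κ s)
    (K P L : ℝ → Matrix (Fin 4) (Fin 4) ℝ)
    (hK : ∀ s, K s =
      !![0, 0, 0, 0;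
         1, 0, -2 * κ s, 0;
         0, 1, 0, -2 * κ s;
         0, 0, 1, 0])
    (hP : ∀ s, P s =
      !![0, 0, 0, 0;
         2 * κ s, 2 * deriv κ s, 2 * deriv (deriv κ) s + 4 * (κ s) ^ 2, 0;
         0, -2 * κ s, 0, 2 * deriv (deriv κ) s + 4 * (κ s) ^ 2;
         2, 0, -2 * κ s, -2 * deriv κ s])
    (hL : ∀ s, L s = P s + lam • K s) :
    (∀ s : ℝ, deriv L s = L s * K s - K s * L s) ∧
    (∀ F : ℝ → Matrix (Fin 4) (Fin 4) ℝ, ContDiff ℝ (⊤ : ℕ∞) F →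
      (∀ s, deriv F s = F s * K s) → (∀ s, IsUnit (F s)) →
      ∀ s₁ s₂ : ℝ, F s₁ * L s₁ * (F s₁)⁻¹ = F s₂ * L s₂ * (F s₂)⁻¹) := by
  have hd : ∀ s, HasDerivAt L (L s * K s - K s * L s) s := by
    intro s
    have c0 : HasDerivAt κ (deriv κ s) s :=
      ((hκ.differentiable (by simp)) s).hasDerivAt
    have hκ1 : ContDiff ℝ (⊤ : ℕ∞) (deriv κ) := (contDiff_infty_iff_deriv.1 hκ).2
    have hκ2 : ContDiff ℝ (⊤ : ℕ∞) (deriv (deriv κ)) := (contDiff_infty_iff_deriv.1 hκ1).2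
    have c1 : HasDerivAt (deriv κ) (deriv (deriv κ) s) s :=
      ((hκ1.differentiable (by simp)) s).hasDerivAt
    have c2 : HasDerivAt (deriv (deriv κ)) (deriv (deriv (deriv κ)) s) s :=
      ((hκ2.differentiable (by simp)) s).hasDerivAt
    have o := hode s
    have z : ∀ c : ℝ, HasDerivAt (fun _ : ℝ => c) 0 s := fun c => hasDerivAt_const s c
    have a0 := c0.const_mul (-2)
    have a1 := (c0.const_mul 2).add_const lam
    have a2 := c1.const_mul 2
    have a3 := ((c2.const_mul 2).add ((c0.pow 2).const_mul 4))
    have a4 := a3.add (a0.const_mul lam)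
    have a5 := a0.add_const lam
    have a6 := c1.const_mul (-2)
    have e : L = fun s => !![0, 0, 0, 0;
         2 * κ s + lam, 2 * deriv κ s,
           2 * deriv (deriv κ) s + 4 * (κ s) ^ 2 + lam * (-2 * κ s), 0;
         0, -2 * κ s + lam, 0,
           2 * deriv (deriv κ) s + 4 * (κ s) ^ 2 + lam * (-2 * κ s);
         2, 0, -2 * κ s + lam, -2 * deriv κ s] := by
      funext s
      rw [hL, hP, hK]
      ext i j
      fin_cases i <;> fin_cases j <;> simp
    have e2 : L s * K s - K s * L s = !![0, 0, 0, 0;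
         2 * deriv κ s, 2 * deriv (deriv κ) s, -4 * κ s * deriv κ s, 0;
         0, -2 * deriv κ s, 0, -4 * κ s * deriv κ s;
         0, 0, -2 * deriv κ s, -2 * deriv (deriv κ) s] := by
      rw [e, hK]
      ext i j
      fin_cases i <;> fin_cases j <;> simp [Matrix.mul_apply, Fin.sum_univ_four] <;> ring
    have a4' : HasDerivAt (fun s => 2 * deriv (deriv κ) s + 4 * (κ s) ^ 2 + lam * (-2 * κ s))
        (-4 * κ s * deriv κ s) s := by
      refine HasDerivAt.congr_deriv a4 ?_
      norm_num
      linear_combination 2 * o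
    rw [e2, e, aux_iff]
    intro i j
    fin_cases i <;> fin_cases j
    exacts [z _, z _, z _, z _, a1, a2, a4', z _, z _, a5, z _, a4', z _, z _, a5, a6]
  refine ⟨fun s => (hd s).deriv, ?_⟩
  intro F hF hF' hu s₁ s₂
  have hz : ∀ s, HasDerivAt (fun s => F s * L s * (F s)⁻¹) 0 s := by
    intro s
    have f : HasDerivAt F (F s * K s) s := by
      rw [← hF' s]
      exact ((hF.differentiable (by simp)) s).hasDerivAt
    convert aux_mul (aux_mul f (hd s)) (aux_inv f (hu s)) using 1
    have h1 : (F s)⁻¹ * F s = 1 :=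
      Matrix.nonsing_inv_mul _ ((Matrix.isUnit_iff_isUnit_det _).1 (hu s))
    rw [← mul_assoc (F s)⁻¹, h1, one_mul]
    noncomm_ring
  exact is_const_of_deriv_eq_zero (fun s => (hz s).differentiableAt) (fun s => (hz s).deriv) s₁ s₂
end
end

section
/- Let c ∈ ℝ and let v : ℝ → ℝ be a smooth solution of the second Painlevé equation v''(x) − 2v(x)³ + x·v(x) + c = 0. Then the function κ := v' − v² satisfies the similarity-reduced KdV equation κ'''(x) + 6κ(x)κ'(x) + (x·κ'(x) + 2κ(x)) = 0 (i.e. the equation κ''' + 6κκ' − (a/3)(xκ' + 2κ) = 0 with a = −3). -/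
noncomputable section

/-- if `v` solves the second Painlevé equation `v'' - 2v³ + xv + c = 0`,
then `κ = v' - v²` solves the similarity-reduced KdV equation
`κ''' + 6κκ' + (xκ' + 2κ) = 0`. -/
theorem stmt19 (c : ℝ) (v : ℝ → ℝ) (hv : ContDiff ℝ (⊤ : ℕ∞) v)
    (hPII : ∀ x : ℝ, deriv (deriv v) x - 2 * (v x) ^ 3 + x * v x + c = 0)
    (κ : ℝ → ℝ) (hκ : ∀ x, κ x = deriv v x - (v x) ^ 2) :
    ∀ x : ℝ,
      deriv (deriv (deriv κ)) x + 6 * κ x * deriv κ x + (x * deriv κ x + 2 * κ x) = 0 := by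
  have hd : ∀ x, HasDerivAt v (deriv v x) x := fun x =>
    (hv.differentiable (by simp) x).hasDerivAt
  have hv1 : ContDiff ℝ 1 (deriv v) := by
    exact (contDiff_infty_iff_deriv.1 hv).2.of_le (by exact_mod_cast le_top)
  have hp : ∀ x, HasDerivAt (deriv v) (2 * (v x) ^ 3 - x * v x - c) x := by
    intro x
    have h := (hv1.differentiable (by simp) x).hasDerivAt
    have e : deriv (deriv v) x = 2 * (v x) ^ 3 - x * v x - c := by linarith [hPII x]
    rwa [e] at h
  have k0 : κ = fun x => deriv v x - (v x) ^ 2 := funext hκ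
  have k1 : deriv κ = fun x => 2 * (v x) ^ 3 - x * v x - c - 2 * (v x * deriv v x) := by
    funext x
    rw [k0]
    refine (((hp x).sub ((hd x).pow 2)).congr_deriv ?_).deriv
    simp; ring
  have k2 : deriv (deriv κ) = fun x => 6 * ((v x) ^ 2 * deriv v x) - v x - x * deriv v x
      - 2 * (deriv v x) ^ 2 - 4 * (v x) ^ 4 + 2 * (x * (v x) ^ 2) + 2 * c * v x := by
    funext x
    rw [k1]
    refine (((((((hd x).pow 3).const_mul 2).sub ((hasDerivAt_id x).mul (hd x))).sub_const c).sub
      (((hd x).mul (hp x)).const_mul 2)).congr_deriv ?_).deriv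
    simp; ring
  intro x
  have k3 := (((((((((((hd x).pow 2).mul (hp x)).const_mul 6).sub (hd x)).sub
    ((hasDerivAt_id x).mul (hp x))).sub (((hp x).pow 2).const_mul 2)).sub
    (((hd x).pow 4).const_mul 4)).add
    (((hasDerivAt_id x).mul ((hd x).pow 2)).const_mul 2)).add ((hd x).const_mul (2 * c)))).deriv
  have k3' := (congrArg (fun f => deriv f x) k2).trans k3
  beta_reduce at k3'
  rw [k3', k1, hκ]
  simp; ring
end
end
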